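/- arXiv:2201.12045 — 3 statements merged into one kernel-verified Lean document; each statement's English description precedes it below -/
import Mathlib

section
/- Let M ≥ 2 and δ > 0. Let x : ℕ → Fin M → ℝ be a sequence of weight vectors and W : ℕ → Fin M → Fin M → ℝ a sequence of row-stochastic matrices (each row nonnegative, summing to 1) with all entries W n m j ≥ δ, such that x (n+1) m = ∑_{j} W n m j * x n j for all n and m. Then there exists a real number L such that for every m, the sequence n ↦ x n m converges to L. -/
open Filter

/-- Iterated averaging by row-stochastic matrices with entries bounded below by `δ > 0`
makes all coordinates converge to a common limit. -/
theorem iterated_row_stochastic_avg_tendsto_common_limit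
    (M : ℕ) (hM : 2 ≤ M) (δ : ℝ) (hδ : 0 < δ)
    (x : ℕ → Fin M → ℝ) (W : ℕ → Fin M → Fin M → ℝ)
    (hWnonneg : ∀ n m j, 0 ≤ W n m j)
    (hWrow : ∀ n m, ∑ j, W n m j = 1)
    (hWδ : ∀ n m j, δ ≤ W n m j)
    (hrec : ∀ n m, x (n + 1) m = ∑ j, W n m j * x n j) :
    ∃ L : ℝ, ∀ m, Tendsto (fun n => x n m) atTop (nhds L) := by
  have : Nonempty (Fin M) := ⟨⟨0, by omega⟩⟩
  have hmax : ∀ n, ∃ i, ∀ j, x n j ≤ x n i := fun n => Finite.exists_max (x n)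
  have hmin : ∀ n, ∃ i, ∀ j, x n i ≤ x n j := fun n => Finite.exists_min (x n)
  choose p hp using hmax
  choose q hq using hmin
  have hup : ∀ n m, x (n + 1) m ≤ x n (p n) - δ * (x n (p n) - x n (q n)) := by
    intro n m
    have h1 : W n m (q n) * (x n (p n) - x n (q n)) ≤ ∑ j, W n m j * (x n (p n) - x n j) :=
      Finset.single_le_sum (f := fun j => W n m j * (x n (p n) - x n j))
        (fun j _ => mul_nonneg (hWnonneg n m j) (sub_nonneg.2 (hp n j))) (Finset.mem_univ _)
    have h2 : ∑ j, W n m j * (x n (p n) - x n j) = x n (p n) - x (n + 1) m := by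
      simp only [mul_sub, Finset.sum_sub_distrib, ← Finset.sum_mul, hWrow, one_mul, hrec]
    have h3 := mul_le_mul_of_nonneg_right (hWδ n m (q n)) (sub_nonneg.2 (hp n (q n)))
    linarith
  have hlo : ∀ n m, x n (q n) ≤ x (n + 1) m := by
    intro n m
    have h1 : 0 ≤ ∑ j, W n m j * (x n j - x n (q n)) :=
      Finset.sum_nonneg
        (fun j _ => mul_nonneg (hWnonneg n m j) (sub_nonneg.2 (hq n j)))
    have h2 : ∑ j, W n m j * (x n j - x n (q n)) = x (n + 1) m - x n (q n) := by
      simp only [mul_sub, Finset.sum_sub_distrib, ← Finset.sum_mul, hWrow, one_mul, hrec]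
    linarith
  have hδ1 : δ ≤ 1 := by
    have h1 : W 0 (p 0) (p 0) ≤ ∑ j, W 0 (p 0) j :=
      Finset.single_le_sum (fun j _ => hWnonneg 0 (p 0) j) (Finset.mem_univ _)
    linarith [hWδ 0 (p 0) (p 0), hWrow 0 (p 0)]
  have hmono : Monotone (fun n => x n (q n)) := monotone_nat_of_le_succ fun n => hlo n _
  have hanti : Antitone (fun n => x n (p n)) := antitone_nat_of_succ_le fun n => by
    have := mul_nonneg hδ.le (sub_nonneg.2 (hp n (q n)))
    linarith [hup n (p (n + 1))]
  have hgap : ∀ n, x n (p n) - x n (q n) ≤ (1 - δ) ^ n * (x 0 (p 0) - x 0 (q 0)) := by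
    intro n
    induction n with
    | zero => simp
    | succ n ih =>
      have h := mul_le_mul_of_nonneg_left ih (sub_nonneg.2 hδ1)
      rw [pow_succ]
      linarith [hup n (p (n + 1)), hlo n (q (n + 1))]
  have hgap0 : Tendsto (fun n => x n (p n) - x n (q n)) atTop (nhds 0) := by
    refine squeeze_zero (fun n => sub_nonneg.2 (hp n _)) hgap ?_
    simpa using (tendsto_pow_atTop_nhds_zero_of_lt_one (sub_nonneg.2 hδ1)
      (by linarith : 1 - δ < 1)).mul_const (x 0 (p 0) - x 0 (q 0))
  have hl : Tendsto (fun n => x n (q n)) atTop (nhds (⨆ n, x n (q n))) := by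
    refine tendsto_atTop_ciSup hmono ⟨x 0 (p 0), ?_⟩
    rintro _ ⟨n, rfl⟩
    exact (hp n _).trans (hanti (Nat.zero_le n))
  have hu : Tendsto (fun n => x n (p n)) atTop (nhds (⨆ n, x n (q n))) := by
    simpa using hl.add hgap0
  exact ⟨_, fun m => tendsto_of_tendsto_of_tendsto_of_le_of_le hl hu
    (fun n => hq n m) (fun n => hp n m)⟩
end

section
/- Let M ≥ 2 and δ > 0. Let x : ℕ → Fin M → ℝ and W : ℕ → Fin M → Fin M → ℝ be as follows: each W n is row-stochastic with all entries ≥ δ, and x (n+1) m = ∑_{j} W n m j * x n j. Define 𝒮 n = Set.Icc (min_m x n m) (max_m x n m) ⊆ ℝ. Then the 𝒮 n are nested (𝒮 (n+1) ⊆ 𝒮 n), their Lebesgue measures satisfy μ(𝒮 n) ≤ (1 − M·δ)^n · μ(𝒮 0), and lim_{n→∞} μ(𝒮 n) = 0, where μ is Lebesgue measure on ℝ. -/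
open Filter MeasureTheory

/-- The intervals spanned by iterated row-stochastic averages (entries ≥ δ) are nested,
their Lebesgue measures decay geometrically with factor `1 − M·δ`, and tend to `0`. -/
theorem iterated_row_stochastic_avg_interval_measure_tendsto_zero
    (M : ℕ) (hM : 2 ≤ M) (δ : ℝ) (hδ : 0 < δ)
    (x : ℕ → Fin M → ℝ) (W : ℕ → Fin M → Fin M → ℝ)
    (hWnonneg : ∀ n m j, 0 ≤ W n m j)
    (hWrow : ∀ n m, ∑ j, W n m j = 1)
    (hWδ : ∀ n m j, δ ≤ W n m j)
    (hrec : ∀ n m, x (n + 1) m = ∑ j, W n m j * x n j)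
    (S : ℕ → Set ℝ)
    (hS : ∀ n, S n = Set.Icc (Finset.univ.inf' ⟨⟨0, by omega⟩, Finset.mem_univ _⟩ (x n))
      (Finset.univ.sup' ⟨⟨0, by omega⟩, Finset.mem_univ _⟩ (x n))) :
    (∀ n, S (n + 1) ⊆ S n) ∧
    (∀ n, volume (S n) ≤ ENNReal.ofReal ((1 - M * δ) ^ n) * volume (S 0)) ∧
    Tendsto (fun n => volume (S n)) atTop (nhds 0) := by
  have hne : (Finset.univ : Finset (Fin M)).Nonempty := ⟨⟨0, by omega⟩, Finset.mem_univ _⟩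
  set a : ℕ → ℝ := fun n => Finset.univ.inf' hne (x n) with ha
  set b : ℕ → ℝ := fun n => Finset.univ.sup' hne (x n) with hb
  have hS' : ∀ n, S n = Set.Icc (a n) (b n) := hS
  have hax : ∀ n m, a n ≤ x n m := fun n m => Finset.inf'_le _ (Finset.mem_univ m)
  have hxb : ∀ n m, x n m ≤ b n := fun n m => Finset.le_sup' _ (Finset.mem_univ m)
  have hMδ : 0 ≤ 1 - M * δ := by
    have h : ∑ _j : Fin M, δ ≤ ∑ j, W 0 ⟨0, by omega⟩ j := Finset.sum_le_sum fun j _ => hWδ _ _ j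
    rw [hWrow] at h
    simp at h
    linarith
  have key : ∀ c : ℝ, (∀ n m j, c ≤ W n m j) → ∀ n m,
      c * ∑ j, x n j + (1 - M * c) * a n ≤ x (n + 1) m ∧
      x (n + 1) m ≤ c * ∑ j, x n j + (1 - M * c) * b n := by
    intro c hc n m
    have e : x (n + 1) m = c * ∑ j, x n j + ∑ j, (W n m j - c) * x n j := by
      rw [hrec, Finset.mul_sum, ← Finset.sum_add_distrib]
      exact Finset.sum_congr rfl fun j _ => by ring
    have e2 : ∀ t : ℝ, (1 - M * c) * t = ∑ j, (W n m j - c) * t := by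
      intro t
      rw [← Finset.sum_mul, Finset.sum_sub_distrib, hWrow]
      simp
    rw [e, e2, e2]
    constructor
    · gcongr with j
      · linarith [hc n m j]
      · exact hax n j
    · gcongr with j
      · linarith [hc n m j]
      · exact hxb n j
  have hnest : ∀ n, a n ≤ a (n + 1) ∧ b (n + 1) ≤ b n := by
    intro n
    constructor
    · refine Finset.le_inf' _ _ fun m _ => ?_
      have := (key 0 hWnonneg n m).1
      simpa using this
    · refine Finset.sup'_le _ _ fun m _ => ?_
      have := (key 0 hWnonneg n m).2
      simpa using this
  have hstep : ∀ n, b (n + 1) - a (n + 1) ≤ (1 - M * δ) * (b n - a n) := by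
    intro n
    have h1 : δ * ∑ j, x n j + (1 - M * δ) * a n ≤ a (n + 1) :=
      Finset.le_inf' _ _ fun m _ => (key δ hWδ n m).1
    have h2 : b (n + 1) ≤ δ * ∑ j, x n j + (1 - M * δ) * b n :=
      Finset.sup'_le _ _ fun m _ => (key δ hWδ n m).2
    linarith
  have hgeo : ∀ n, b n - a n ≤ (1 - M * δ) ^ n * (b 0 - a 0) := by
    intro n
    induction n with
    | zero => simp
    | succ k ih =>
      calc _ ≤ _ := hstep k
        _ ≤ (1 - M * δ) * ((1 - M * δ) ^ k * (b 0 - a 0)) := by gcongr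
        _ = _ := by ring
  have hvol : ∀ n, volume (S n) ≤ ENNReal.ofReal ((1 - M * δ) ^ n) * volume (S 0) := by
    intro n
    rw [hS', hS', Real.volume_Icc, Real.volume_Icc, ← ENNReal.ofReal_mul (by positivity)]
    exact ENNReal.ofReal_le_ofReal (hgeo n)
  refine ⟨fun n => ?_, hvol, ?_⟩
  · rw [hS', hS']
    exact Set.Icc_subset_Icc (hnest n).1 (hnest n).2
  · have hlt : 1 - M * δ < 1 := by
      have : (0 : ℝ) < M := by exact_mod_cast (by omega : 0 < M)
      have := mul_pos this hδ
      linarith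
    have ht : Tendsto (fun n : ℕ => ENNReal.ofReal ((1 - M * δ) ^ n * (b 0 - a 0))) atTop
        (nhds 0) := by
      have := ENNReal.tendsto_ofReal
        ((tendsto_pow_atTop_nhds_zero_of_lt_one hMδ hlt).mul_const (b 0 - a 0))
      simpa using this
    refine tendsto_of_tendsto_of_tendsto_of_le_of_le tendsto_const_nhds ht
      (fun n => zero_le) (fun n => ?_)
    show volume (S n) ≤ _
    rw [hS', Real.volume_Icc]
    exact ENNReal.ofReal_le_ofReal (hgeo n)
end

section
/- Let Ω be a topological space with its Borel σ-algebra, K ≥ 1 and M ≥ 2, let p : Fin K → ProbabilityMeasure Ω be the base models, and let δ > 0. Suppose for each base model k the weights ω : ℕ → Fin K → Fin M → ℝ satisfy: ω n k m ≥ 0, ∑_k ω n k m = 1 for every n and m, and the layer recursion ω (n+1) k m = ∑_{j} W n m j * ω n k j holds, where each W n is a row-stochastic M×M matrix with all entries ≥ δ. Then there exist limit weights ω* : Fin K → ℝ with ω* k ≥ 0 and ∑_k ω* k = 1, independent of m, such that for every m and every bounded continuous f : Ω → ℝ, ∑_k ω n k m * ∫ f d(p k) → ∑_k ω* k * ∫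 f d(p k); i.e., the mixtures p^{(n)}_m = ∑_k ω n k m • p k converge weakly, for every starting model m, to the common limit mixture p* = ∑_k ω* k • p k. -/
open Filter MeasureTheory BoundedContinuousFunction

theorem ldf_consensus_aux (M : ℕ) (hM : 2 ≤ M) (δ : ℝ) (hδ : 0 < δ)
    (x : ℕ → Fin M → ℝ) (W : ℕ → Fin M → Fin M → ℝ)
    (hWrow : ∀ n m, ∑ j, W n m j = 1)
    (hWδ : ∀ n m j, δ ≤ W n m j)
    (hrec : ∀ n m, x (n + 1) m = ∑ j, W n m j * x n j) :
    ∃ L : ℝ, ∀ m, Tendsto (fun n => x n m) atTop (nhds L) := by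
  have hne : Nonempty (Fin M) := ⟨⟨0, by omega⟩⟩
  have hW0 : ∀ n m j, 0 ≤ W n m j := fun n m j => hδ.le.trans (hWδ n m j)
  have hδ1 : δ ≤ 1 := by
    obtain ⟨m⟩ := hne
    rw [← hWrow 0 m]
    exact (hWδ 0 m m).trans (Finset.single_le_sum (fun j _ => hW0 0 m j) (Finset.mem_univ m))
  set a : ℕ → ℝ := fun n => ⨅ m, x n m with ha
  set b : ℕ → ℝ := fun n => ⨆ m, x n m with hb
  have hax : ∀ n m, a n ≤ x n m := fun n m => ciInf_le (Set.finite_range _).bddBelow m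
  have hxb : ∀ n m, x n m ≤ b n := fun n m => le_ciSup (Set.finite_range _).bddAbove m
  have hab : ∀ n, a n ≤ b n := fun n => hne.elim fun m => (hax n m).trans (hxb n m)
  have hup : ∀ n, b (n + 1) ≤ b n - δ * (b n - a n) := by
    intro n
    refine ciSup_le fun m => ?_
    obtain ⟨j0, hj0⟩ := exists_eq_ciInf_of_finite (f := x n)
    have h1 : b n - x (n + 1) m = ∑ j, W n m j * (b n - x n j) := by
      simp only [mul_sub, Finset.sum_sub_distrib, ← Finset.sum_mul, hWrow, hrec, one_mul]
    have h2 : W n m j0 * (b n - x n j0) ≤ ∑ j, W n m j * (b n - x n j) :=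
      Finset.single_le_sum (f := fun j => W n m j * (b n - x n j))
        (fun j _ => mul_nonneg (hW0 n m j) (sub_nonneg.2 (hxb n j))) (Finset.mem_univ j0)
    have h3 : x n j0 = a n := hj0
    rw [h3] at h2
    have h4 := mul_le_mul_of_nonneg_right (hWδ n m j0) (sub_nonneg.2 (hab n))
    linarith
  have hlow : ∀ n, a n ≤ a (n + 1) := by
    intro n
    refine le_ciInf fun m => ?_
    rw [hrec]
    calc a n = ∑ j, W n m j * a n := by rw [← Finset.sum_mul, hWrow, one_mul]
      _ ≤ _ := Finset.sum_le_sum fun j _ => mul_le_mul_of_nonneg_left (hax n j) (hW0 n m j)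
  have hdiff : ∀ n, b n - a n ≤ (1 - δ) ^ n * (b 0 - a 0) := by
    intro n
    induction n with
    | zero => simp
    | succ n ih =>
      have h1 := hup n
      have h2 := hlow n
      have h3 := mul_le_mul_of_nonneg_left ih (sub_nonneg.2 hδ1)
      rw [pow_succ]
      linarith
  have hpow : Tendsto (fun n : ℕ => (1 - δ) ^ n * (b 0 - a 0)) atTop (nhds 0) := by
    simpa using (tendsto_pow_atTop_nhds_zero_of_lt_one (sub_nonneg.2 hδ1)
      (by linarith : 1 - δ < 1)).mul_const (b 0 - a 0)
  have hbanti : Antitone b := antitone_nat_of_succ_le fun n => by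
    have := mul_nonneg hδ.le (sub_nonneg.2 (hab n))
    linarith [hup n]
  have hamono : Monotone a := monotone_nat_of_le_succ hlow
  have hbdd : BddAbove (Set.range a) :=
    ⟨b 0, by rintro _ ⟨n, rfl⟩; exact (hab n).trans (hbanti (Nat.zero_le n))⟩
  have hL := tendsto_atTop_ciSup hamono hbdd
  refine ⟨_, fun m => tendsto_of_tendsto_of_tendsto_of_le_of_le hL
    (by simpa using hL.add hpow) (fun n => hax n m) (fun n => ?_)⟩
  have := hxb n m
  have := hdiff n
  show x n m ≤ a n + (1 - δ) ^ n * (b 0 - a 0)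
  linarith

/-- Theorem 1 (Convergence for softmax): in the n-layer Loss Discounting Framework,
where each layer's mixture weights are convex combinations (with combination weights
bounded below by `δ > 0`) of the previous layer's weights, the layer-n mixtures
`p^{(n)}_m = ∑_k ω n k m • p k` converge weakly, for every starting model `m`,
to a common limit mixture `p* = ∑_k ω* k • p k` independent of `m`. -/
theorem ldf_softmax_convergence_in_distribution
    {Ω : Type*} [TopologicalSpace Ω] [MeasurableSpace Ω] [BorelSpace Ω]
    (K M : ℕ) (hK : 1 ≤ K) (hM : 2 ≤ M)
    (p : Fin K → ProbabilityMeasure Ω) (δ : ℝ) (hδ : 0 < δ)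
    (ω : ℕ → Fin K → Fin M → ℝ) (W : ℕ → Fin M → Fin M → ℝ)
    (hωnonneg : ∀ n k m, 0 ≤ ω n k m)
    (hωsum : ∀ n m, ∑ k, ω n k m = 1)
    (hWnonneg : ∀ n m j, 0 ≤ W n m j)
    (hWrow : ∀ n m, ∑ j, W n m j = 1)
    (hWδ : ∀ n m j, δ ≤ W n m j)
    (hrec : ∀ n k m, ω (n + 1) k m = ∑ j, W n m j * ω n k j) :
    ∃ ωstar : Fin K → ℝ, (∀ k, 0 ≤ ωstar k) ∧ (∑ k, ωstar k = 1) ∧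
      ∀ m, ∀ f : Ω →ᵇ ℝ,
        Tendsto (fun n => ∑ k, ω n k m * ∫ x, f x ∂(p k : Measure Ω)) atTop
          (nhds (∑ k, ωstar k * ∫ x, f x ∂(p k : Measure Ω))) := by
  have h := fun k => ldf_consensus_aux M hM δ hδ (fun n m => ω n k m) W hWrow hWδ
    (fun n m => hrec n k m)
  choose L hL using h
  have m0 : Fin M := ⟨0, by omega⟩
  refine ⟨L, fun k => ge_of_tendsto' (hL k m0) (fun n => hωnonneg n k m0), ?_, fun m f => ?_⟩
  · have h1 := tendsto_finsetSum Finset.univ (fun k _ => hL k m0)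
    simp only [hωsum] at h1
    exact tendsto_nhds_unique h1 tendsto_const_nhds
  · exact tendsto_finsetSum Finset.univ (fun k _ => (hL k m).mul_const _)
end
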